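/- For every positive integer N, every integer n with 0 ≤ n ≤ N−1, and every complex Λ with 0 < |Λ| < 1, the variance of the excitation energy in the N-state Schrödinger cat Φ = ∑_{m=0}^{N−1} e^{−2πimn/N} Coh(Λe^{2πim/N}) ∈ ℓ²(ℕ, ℂ) is (ΔE)²_Φ = N² |Λ|^{2N} / (1 − |Λ|^{2N})²; equivalently, the quantum Fisher information of Φ is 4N²|Λ|^{2N}/(1 − |Λ|^{2N})². -/

import Mathlib

/-- Orthogonality of the characters of `ℤ/Nℤ`. -/
theorem IsPrimitiveRoot.sum_zpow_pow {K : Type*} [Field K] {ζ : K} {N : ℕ}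
    (hζ : IsPrimitiveRoot ζ N) (a : ℤ) :
    ∑ m ∈ Finset.range N, (ζ ^ a) ^ m = if (N : ℤ) ∣ a then (N : K) else 0 := by
  split_ifs with h
  · simp [(hζ.zpow_eq_one_iff_dvd a).2 h]
  · have hne : ζ ^ a ≠ 1 := fun h' => h ((hζ.zpow_eq_one_iff_dvd a).1 h')
    have hN : (ζ ^ a) ^ N = 1 := by
      rw [← zpow_natCast, ← zpow_mul, mul_comm, zpow_mul, zpow_natCast, hζ.pow_eq_one, one_zpow]
    rw [geom_sum_eq hne, hN, sub_self, zero_div]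

theorem cat_coeff_eq {N : ℕ} (hN : 0 < N) (n : ℕ) (Λ : ℂ) (j : ℕ) :
    ∑ m ∈ Finset.range N,
      Complex.exp (-(2 * (Real.pi : ℂ) * Complex.I * (m : ℂ) * (n : ℂ) / (N : ℂ))) *
        (Λ * Complex.exp (2 * (Real.pi : ℂ) * Complex.I * (m : ℂ) / (N : ℂ))) ^ j
      = if (N : ℤ) ∣ (j : ℤ) - n then (N : ℂ) * Λ ^ j else 0 := by
  have key := (Complex.isPrimitiveRoot_exp N hN.ne').sum_zpow_pow ((j : ℤ) - n)
  calc _ = Λ ^ j * ∑ m ∈ Finset.range N,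
        (Complex.exp (2 * Real.pi * Complex.I / N) ^ ((j : ℤ) - n)) ^ m := by
        rw [Finset.mul_sum]
        refine Finset.sum_congr rfl fun m _ => ?_
        rw [mul_pow, mul_left_comm, ← Complex.exp_int_mul, ← Complex.exp_nat_mul,
          ← Complex.exp_nat_mul, ← Complex.exp_add]
        congr 2
        push_cast
        ring
    _ = _ := by
        rw [key]
        split_ifs <;> ring

/-- The second moment of the geometric series. -/
theorem hasSum_sq_mul_geometric {q : ℝ} (hq : ‖q‖ < 1) :
    HasSum (fun k : ℕ => (k : ℝ) ^ 2 * q ^ k) (q * (1 + q) / (1 - q) ^ 3) := by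
  have hne : 1 - q ≠ 0 := by
    have := (abs_lt.1 hq).2
    linarith
  have h2 := hasSum_choose_mul_geometric_of_norm_lt_one 2 hq
  have h1 := hasSum_coe_mul_geometric_of_norm_lt_one hq
  have h0 := hasSum_geometric_of_norm_lt_one hq
  have hk : ∀ k : ℕ, (k : ℝ) ^ 2 * q ^ k =
      2 * (((k + 2).choose 2 : ℕ) * q ^ k) - 3 * (k * q ^ k) - 2 * q ^ k := fun k => by
    rw [Nat.cast_choose_two]
    push_cast
    ring
  have hs : q * (1 + q) / (1 - q) ^ 3 =
      2 * (1 / (1 - q) ^ (2 + 1)) - 3 * (q / (1 - q) ^ 2) - 2 * (1 - q)⁻¹ := by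
    field_simp
    ring
  rw [funext hk, hs]
  exact ((h2.mul_left 2).sub (h1.mul_left 3)).sub (h0.mul_left 2)

/-- Sums weighted by the squared coefficients of the cat state reduce to its residue class. -/
theorem tsum_cat_weight {N n : ℕ} (hn : n < N) {Λ : ℂ} {c : ℕ → ℂ}
    (hc : ∀ j : ℕ, c j = if (N : ℤ) ∣ (j : ℤ) - n then (N : ℂ) * Λ ^ j else 0) (f : ℕ → ℝ) :
    ∑' j : ℕ, f j * ‖c j‖ ^ 2 =
      ∑' k : ℕ, f (n + N * k) * ((N : ℝ) ^ 2 * ‖Λ‖ ^ (2 * n) * (‖Λ‖ ^ (2 * N)) ^ k) := by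
  have hinj : Function.Injective fun k : ℕ => n + N * k := fun a b h =>
    Nat.eq_of_mul_eq_mul_left (Nat.zero_lt_of_lt hn) (Nat.add_left_cancel h)
  rw [← hinj.tsum_eq]
  · refine tsum_congr fun k => ?_
    rw [hc, if_pos ⟨k, by push_cast; ring⟩, norm_mul, norm_pow, Complex.norm_natCast]
    ring
  · intro j hj
    have hdvd : (N : ℤ) ∣ (j : ℤ) - n := by
      by_contra h
      simp [hc, h] at hj
    obtain ⟨k, hk⟩ := hdvd
    have hk0 : 0 ≤ k := by
      by_contra! h
      nlinarith
    lift k to ℕ using hk0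
    exact ⟨k, by zify; linarith⟩


/-- For every positive integer `N`, integer `n` with `0 ≤ n ≤ N−1`, and
complex `Λ` with `0 < |Λ| < 1`, the variance of the excitation energy in the `N`-state
Schrödinger cat `Φ = ∑_{m=0}^{N−1} e^{−2πimn/N} Coh(Λe^{2πim/N})` (with `Δ_j`-coefficients
`c j`) is `(ΔE)²_Φ = N² |Λ|^{2N}/(1 − |Λ|^{2N})²`; equivalently, the quantum Fisher information
`QFI(Φ) = 4(ΔE)²_Φ` equals `4N²|Λ|^{2N}/(1 − |Λ|^{2N})²`. -/
theorem N_cat_energy_variance (N : ℕ) (hN : 0 < N) (n : ℕ) (hn : n < N)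
    (Λ : ℂ) (h0 : Λ ≠ 0) (h1 : ‖Λ‖ < 1)
    (c : ℕ → ℂ)
    (hc : ∀ j : ℕ, c j = ∑ m ∈ Finset.range N,
      Complex.exp (-(2 * (Real.pi : ℂ) * Complex.I * (m : ℂ) * (n : ℂ) / (N : ℂ))) *
        (Λ * Complex.exp (2 * (Real.pi : ℂ) * Complex.I * (m : ℂ) / (N : ℂ))) ^ j) :
    (∑' j : ℕ, (j : ℝ) ^ 2 * ‖c j‖ ^ 2) / (∑' j : ℕ, ‖c j‖ ^ 2)
        - ((∑' j : ℕ, (j : ℝ) * ‖c j‖ ^ 2) / (∑' j : ℕ, ‖c j‖ ^ 2)) ^ 2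
      = (N : ℝ) ^ 2 * ‖Λ‖ ^ (2 * N) / (1 - ‖Λ‖ ^ (2 * N)) ^ 2 ∧
    4 * ((∑' j : ℕ, (j : ℝ) ^ 2 * ‖c j‖ ^ 2) / (∑' j : ℕ, ‖c j‖ ^ 2)
        - ((∑' j : ℕ, (j : ℝ) * ‖c j‖ ^ 2) / (∑' j : ℕ, ‖c j‖ ^ 2)) ^ 2)
      = 4 * (N : ℝ) ^ 2 * ‖Λ‖ ^ (2 * N) / (1 - ‖Λ‖ ^ (2 * N)) ^ 2 := by
  have hc' : ∀ j : ℕ, c j = if (N : ℤ) ∣ (j : ℤ) - n then (N : ℂ) * Λ ^ j else 0 := fun j =>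
    (hc j).trans (cat_coeff_eq hN n Λ j)
  have hq1 : ‖Λ‖ ^ (2 * N) < 1 := pow_lt_one₀ (norm_nonneg _) h1 (by positivity)
  have hA : (N : ℝ) ^ 2 * ‖Λ‖ ^ (2 * n) ≠ 0 := by
    have := norm_pos_iff.2 h0
    positivity
  have hq : ‖‖Λ‖ ^ (2 * N)‖ < 1 := by rwa [Real.norm_of_nonneg (by positivity)]
  have S0 := tsum_cat_weight hn hc' fun _ => 1
  have S1 := tsum_cat_weight hn hc' fun j => (j : ℝ)
  have S2 := tsum_cat_weight hn hc' fun j => (j : ℝ) ^ 2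
  generalize ‖Λ‖ ^ (2 * N) = q at *
  generalize (N : ℝ) ^ 2 * ‖Λ‖ ^ (2 * n) = A at *
  have g0 := hasSum_geometric_of_norm_lt_one hq
  have g1 := hasSum_coe_mul_geometric_of_norm_lt_one hq
  have g2 := hasSum_sq_mul_geometric hq
  have hne : 1 - q ≠ 0 := by linarith
  have T0 : ∑' j : ℕ, ‖c j‖ ^ 2 = A * (1 - q)⁻¹ := by
    simpa only [one_mul, (g0.mul_left A).tsum_eq] using S0
  have T1 : ∑' j : ℕ, (j : ℝ) * ‖c j‖ ^ 2 = A * (n * (1 - q)⁻¹ + N * (q / (1 - q) ^ 2)) := by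
    rw [S1, ← (((g0.mul_left (n : ℝ)).add (g1.mul_left (N : ℝ))).mul_left A).tsum_eq]
    refine tsum_congr fun k => ?_
    push_cast
    ring
  have T2 : ∑' j : ℕ, (j : ℝ) ^ 2 * ‖c j‖ ^ 2 = A * ((n : ℝ) ^ 2 * (1 - q)⁻¹ +
      2 * n * N * (q / (1 - q) ^ 2) + (N : ℝ) ^ 2 * (q * (1 + q) / (1 - q) ^ 3)) := by
    rw [S2, ← ((((g0.mul_left ((n : ℝ) ^ 2)).add (g1.mul_left (2 * n * N : ℝ))).add
      (g2.mul_left ((N : ℝ) ^ 2))).mul_left A).tsum_eq]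
    refine tsum_congr fun k => ?_
    push_cast
    ring
  rw [T0, T1, T2]
  constructor <;>
  · field_simp
    ring
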